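/- The number of n-cycles in S_n whose descent set is contained in {r_1, r_1+r_2, ..., r_1+...+r_a = n} equals M(r_1,...,r_a) = (1/n) Σ_{d | gcd(n,r_1,...,r_a)} μ(d)·(n/d)!/((r_1/d)!···(r_a/d)!). -/

import Mathlib

/-- The value of `π` at the (0-indexed) position `i`, extended by `0` outside the range. -/
def permVal (n : ℕ) (π : Equiv.Perm (Fin n)) (i : ℕ) : ℕ :=
  if h : i < n then (π ⟨i, h⟩ : ℕ) else 0

/-- The descent set of `π ∈ S_n` (with the convention that `n` is always a descent). -/
def descentSet (n : ℕ) (π : Equiv.Perm (Fin n)) : Finset ℕ :=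
  insert n ((Finset.Ico 1 n).filter fun i => permVal n π i < permVal n π (i - 1))

/-- The set of partial sums `{r₁, r₁+r₂, …, r₁+⋯+r_a}`. -/
def partialSumsF (a : ℕ) (r : Fin a → ℕ) : Finset ℕ :=
  Finset.univ.image fun j : Fin a => ∑ i ∈ Finset.univ.filter (· ≤ j), r i

/-- The full cycle type of a permutation: the multiset of the lengths of all its
cycles, including fixed points as cycles of length 1. -/
def fullCycleType (n : ℕ) (π : Equiv.Perm (Fin n)) : Multiset ℕ :=
  π.cycleType + Multiset.replicate (n - π.cycleType.sum) 1


open Finset Equiv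

section Words

variable {X : Type*} [Fintype X] {a : ℕ}

/-- The words indexed by `X` in which the letter `i` occurs `r i` times. -/
def wordsOfContent (X : Type*) [Fintype X] [DecidableEq X] {a : ℕ} (r : Fin a → ℕ) :
    Finset (X → Fin a) :=
  univ.filter fun w => ∀ i, #{x | w x = i} = r i

theorem mem_wordsOfContent [DecidableEq X] {r : Fin a → ℕ} {w : X → Fin a} :
    w ∈ wordsOfContent X r ↔ ∀ i, #{x | w x = i} = r i := by
  simp [wordsOfContent]

theorem wordsOfContent_nonempty [DecidableEq X] {r : Fin a → ℕ}
    (hr : ∑ i, r i = Fintype.card X) : (wordsOfContent X r).Nonempty := by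
  let e : X ≃ Σ i, Fin (r i) := Fintype.equivOfCardEq (by simp [hr])
  refine ⟨fun x => (e x).1, mem_wordsOfContent.2 fun i => ?_⟩
  rw [← Fintype.card_subtype,
    Fintype.card_congr (e.subtypeEquiv (q := fun s => s.1 = i) fun _ => Iff.rfl),
    Fintype.card_congr (Equiv.sigmaSubtype i), Fintype.card_fin]

theorem comp_perm_mem_wordsOfContent {Y : Type*} [Fintype Y] [DecidableEq X] [DecidableEq Y]
    {r : Fin a → ℕ} {w : X → Fin a} (hw : w ∈ wordsOfContent X r) (e : Y ≃ X) :
    w ∘ e ∈ wordsOfContent Y r := by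
  rw [mem_wordsOfContent] at *
  intro i
  rw [← hw i]
  exact Finset.card_equiv e (by simp)

theorem exists_perm_comp_eq [DecidableEq X] {r : Fin a → ℕ} {w w' : X → Fin a}
    (hw : w ∈ wordsOfContent X r) (hw' : w' ∈ wordsOfContent X r) :
    ∃ σ : Perm X, w ∘ σ = w' := by
  rw [mem_wordsOfContent] at hw hw'
  have h (i : Fin a) : Nonempty ({x // w' x = i} ≃ {x // w x = i}) := by
    refine ⟨Fintype.equivOfCardEq ?_⟩
    rw [Fintype.card_subtype, Fintype.card_subtype, hw, hw']
  exact ⟨Equiv.ofFiberEquiv fun i => (h i).some, funext fun x => Equiv.ofFiberEquiv_map _ x⟩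

theorem card_wordsOfContent_mul [DecidableEq X] {r : Fin a → ℕ}
    (hr : ∑ i, r i = Fintype.card X) :
    #(wordsOfContent X r) * ∏ i, (r i).factorial = (Fintype.card X).factorial := by
  obtain ⟨w₀, hw₀⟩ := wordsOfContent_nonempty hr
  rw [← Fintype.card_perm, ← Finset.card_univ (α := Perm X),
    card_eq_sum_card_fiberwise (f := fun σ : Perm X => w₀ ∘ σ) (t := wordsOfContent X r)
      fun σ _ => comp_perm_mem_wordsOfContent hw₀ σ, ← smul_eq_mul, ← sum_const]
  refine sum_congr rfl fun w hw => ?_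
  obtain ⟨σ₀, rfl⟩ := exists_perm_comp_eq hw₀ hw
  have hst := DomMulAct.stabilizer_card (w₀ ∘ σ₀)
  simp only [Fintype.card_subtype, mem_wordsOfContent.1 hw] at hst
  rw [← hst]
  refine Finset.card_equiv (Equiv.mulLeft σ₀) fun σ => ?_
  simp [Function.comp_assoc]

end Words

section Block

variable {n a : ℕ} {r : Fin a → ℕ}

theorem exists_monotone_mem_wordsOfContent (hr : ∑ i, r i = n) :
    ∃ f ∈ wordsOfContent (Fin n) r, Monotone f := by
  obtain ⟨w, hw⟩ := wordsOfContent_nonempty (X := Fin n) (r := r) (by simpa using hr)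
  exact ⟨w ∘ Tuple.sort w, comp_perm_mem_wordsOfContent hw _, Tuple.monotone_sort w⟩

theorem Monotone.apply_le_iff_of_mem_wordsOfContent {f : Fin n → Fin a} (hf : Monotone f)
    (hfr : f ∈ wordsOfContent (Fin n) r) (x : Fin n) (j : Fin a) :
    f x ≤ j ↔ (x : ℕ) < ∑ i ∈ univ.filter (· ≤ j), r i := by
  have hcard : #{x | f x ≤ j} = ∑ i ∈ univ.filter (· ≤ j), r i := by
    rw [card_eq_sum_card_fiberwise (f := f) (t := univ.filter (· ≤ j)) (by intro x; simp)]
    refine sum_congr rfl fun i hi => ?_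
    rw [← mem_wordsOfContent.1 hfr i]
    congr 1
    ext x
    simp only [mem_filter, mem_univ, true_and] at *
    exact ⟨fun h => h.2, fun h => ⟨h ▸ hi, h⟩⟩
  rw [← hcard]
  constructor
  · intro hx
    have : Iic x ⊆ univ.filter fun x => f x ≤ j := fun y hy => by
      simpa using (hf (mem_Iic.1 hy)).trans hx
    have := card_le_card this
    rw [Fin.card_Iic] at this
    omega
  · intro hx
    by_contra hlt
    have : (univ.filter fun x => f x ≤ j) ⊆ Iio x := fun y hy => by
      rw [mem_Iio]
      by_contra hxy
      exact hlt ((hf (not_lt.1 hxy)).trans (by simpa using hy))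
    have := card_le_card this
    rw [Fin.card_Iio] at this
    omega

theorem Monotone.eq_of_mem_wordsOfContent {f g : Fin n → Fin a} (hf : Monotone f)
    (hg : Monotone g) (hfr : f ∈ wordsOfContent (Fin n) r)
    (hgr : g ∈ wordsOfContent (Fin n) r) : f = g := by
  funext x
  refine eq_of_forall_ge_iff fun j => ?_
  rw [hf.apply_le_iff_of_mem_wordsOfContent hfr, hg.apply_le_iff_of_mem_wordsOfContent hgr]

theorem descentSet_subset_partialSumsF_iff (hn : 0 < n) (hr : ∑ i, r i = n)
    {f : Fin n → Fin a} (hf : Monotone f) (hfr : f ∈ wordsOfContent (Fin n) r)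
    (π : Perm (Fin n)) :
    descentSet n π ⊆ partialSumsF a r ↔ ∀ x y, f x = f y → x < y → π x < π y := by
  have hle := hf.apply_le_iff_of_mem_wordsOfContent hfr
  constructor
  · intro h
    have step (i : ℕ) (hi : i + 1 < n) (hfi : f ⟨i, by omega⟩ = f ⟨i + 1, hi⟩) :
        π ⟨i, by omega⟩ < π ⟨i + 1, hi⟩ := by
      by_contra hlt
      have hne : π ⟨i + 1, hi⟩ ≠ π ⟨i, by omega⟩ := fun hc => by
        have := π.injective hc
        simp at this
      have hd : i + 1 ∈ descentSet n π := by
        refine mem_insert_of_mem (mem_filter.2 ⟨mem_Ico.2 ⟨by omega, hi⟩, ?_⟩)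
        simp only [permVal, hi, Nat.add_sub_cancel, show i < n by omega, dite_true]
        exact lt_of_le_of_ne (not_lt.1 hlt) fun hc => hne (Fin.ext hc)
      obtain ⟨j, -, hj⟩ := mem_image.1 (h hd)
      have h1 := (hle ⟨i, by omega⟩ j).2 (by rw [hj]; exact Nat.lt_succ_self i)
      rw [hfi, hle, hj] at h1
      exact lt_irrefl _ h1
    have key (d : ℕ) : ∀ (i : ℕ) (hi : i + d + 1 < n),
        f ⟨i, by omega⟩ = f ⟨i + d + 1, hi⟩ → π ⟨i, by omega⟩ < π ⟨i + d + 1, hi⟩ := by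
      induction d with
      | zero => exact fun i hi => step i hi
      | succ d ih =>
        intro i hi hfi
        have h1 : f ⟨i, by omega⟩ ≤ f ⟨i + d + 1, by omega⟩ := hf (Fin.mk_le_mk.2 (by omega))
        have h2 : f ⟨i + d + 1, by omega⟩ ≤ f ⟨i + (d + 1) + 1, hi⟩ :=
          hf (Fin.mk_le_mk.2 (by omega))
        exact (ih i (by omega) (le_antisymm h1 (hfi ▸ h2))).trans
          (step (i + d + 1) hi (le_antisymm h2 (hfi ▸ h1)))
    rintro ⟨x, hx⟩ ⟨y, hy⟩ hxy hlt
    obtain ⟨d, rfl⟩ := Nat.exists_eq_add_of_lt (Fin.mk_lt_mk.1 hlt)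
    exact key d x hy hxy
  · intro h i hi
    rcases mem_insert.1 hi with rfl | hi
    · have ha : a ≠ 0 := by
        rintro rfl
        simp at hr
        omega
      refine mem_image.2 ⟨⟨a - 1, by omega⟩, mem_univ _, ?_⟩
      rw [← hr]
      refine sum_congr (filter_true_of_mem fun k _ => ?_) fun _ _ => rfl
      exact Fin.mk_le_mk.2 (by omega)
    · obtain ⟨hi, hdesc⟩ := mem_filter.1 hi
      rw [mem_Ico] at hi
      simp only [permVal, hi.2, show i - 1 < n by omega, dite_true] at hdesc
      have hx := hle ⟨i - 1, by omega⟩ (f ⟨i - 1, by omega⟩)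
      have hy := hle ⟨i, hi.2⟩ (f ⟨i - 1, by omega⟩)
      have hlt : (⟨i - 1, by omega⟩ : Fin n) < ⟨i, hi.2⟩ := Fin.mk_lt_mk.2 (by omega)
      have hf' : ¬ f ⟨i, hi.2⟩ ≤ f ⟨i - 1, by omega⟩ := fun hc =>
        lt_asymm hdesc (h _ _ (le_antisymm (hf hlt.le) hc) hlt)
      refine mem_image.2 ⟨f ⟨i - 1, by omega⟩, mem_univ _, ?_⟩
      have := hx.1 le_rfl
      have := mt hy.2 hf'
      simp only at *
      omega

end Block

section Primitive

variable {n a : ℕ} {r : Fin a → ℕ}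

/-- The cyclic shift of a word indexed by `ZMod n`. -/
def cyclicShift (n a : ℕ) (w : ZMod n → Fin a) : ZMod n → Fin a := fun j => w (j + 1)

theorem cyclicShift_iterate (w : ZMod n → Fin a) (m : ℕ) (j : ZMod n) :
    (cyclicShift n a)^[m] w j = w (j + m) := by
  induction m generalizing w with
  | zero => simp
  | succ m ih =>
    rw [Function.iterate_succ_apply, ih, cyclicShift]
    push_cast
    rw [add_assoc]

theorem isPeriodicPt_cyclicShift_iff {w : ZMod n → Fin a} {m : ℕ} :
    Function.IsPeriodicPt (cyclicShift n a) m w ↔ ∀ j, w (j + m) = w j := by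
  simp only [Function.IsPeriodicPt, Function.IsFixedPt, funext_iff, cyclicShift_iterate]

theorem isPeriodicPt_cyclicShift_self (w : ZMod n → Fin a) :
    Function.IsPeriodicPt (cyclicShift n a) n w := by
  simp [isPeriodicPt_cyclicShift_iff]

/-- The primitive words of content `r`: those whose `n` cyclic shifts are distinct. -/
noncomputable def primitiveWords (n : ℕ) [NeZero n] {a : ℕ} (r : Fin a → ℕ) :
    Finset (ZMod n → Fin a) :=
  (wordsOfContent (ZMod n) r).filter fun w => Function.minimalPeriod (cyclicShift n a) w = n

open Classical in
theorem sum_moebius_isPeriodicPt [NeZero n] (w : ZMod n → Fin a) :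
    (∑ d ∈ n.divisors, if Function.IsPeriodicPt (cyclicShift n a) (n / d) w then
      (ArithmeticFunction.moebius d : ℚ) else 0) =
      if Function.minimalPeriod (cyclicShift n a) w = n then 1 else 0 := by
  have hn : n ≠ 0 := NeZero.ne n
  obtain ⟨k, hk⟩ := (isPeriodicPt_cyclicShift_self w).minimalPeriod_dvd
  set p := Function.minimalPeriod (cyclicShift n a) w with hp
  have hp0 : p ≠ 0 := by rintro h; rw [h, zero_mul] at hk; exact hn hk
  have hk0 : k ≠ 0 := by rintro h; rw [h, mul_zero] at hk; exact hn hk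
  rw [← sum_filter]
  have hfil : n.divisors.filter
      (fun d => Function.IsPeriodicPt (cyclicShift n a) (n / d) w) = k.divisors := by
    ext d
    simp only [mem_filter, Nat.mem_divisors, Function.isPeriodicPt_iff_minimalPeriod_dvd, ← hp]
    constructor
    · rintro ⟨⟨⟨e, he⟩, -⟩, hd⟩
      have hd0 : d ≠ 0 := by rintro rfl; simp at he; exact hn he
      rw [he, Nat.mul_div_cancel_left _ (Nat.pos_of_ne_zero hd0)] at hd
      obtain ⟨c, rfl⟩ := hd
      refine ⟨⟨c, ?_⟩, hk0⟩
      apply Nat.eq_of_mul_eq_mul_left (Nat.pos_of_ne_zero hp0)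
      rw [← hk, he]
      ring
    · rintro ⟨⟨c, rfl⟩, -⟩
      have hd0 : d ≠ 0 := by rintro rfl; simp at hk0
      have hpd : n = d * (p * c) := by rw [hk]; ring
      refine ⟨⟨⟨_, hpd⟩, hn⟩, ?_⟩
      rw [hpd, Nat.mul_div_cancel_left _ (Nat.pos_of_ne_zero hd0)]
      exact dvd_mul_right _ _
  rw [hfil]
  have hmu := congrArg (fun F => F k) ArithmeticFunction.coe_zeta_mul_moebius
  simp only [ArithmeticFunction.coe_zeta_mul_apply, ArithmeticFunction.one_apply] at hmu
  rw [← Int.cast_sum, hmu]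
  have : p = n ↔ k = 1 := by
    rw [hk]
    constructor
    · intro h
      exact Nat.eq_of_mul_eq_mul_left (Nat.pos_of_ne_zero hp0) (by rw [← h, mul_one])
    · rintro rfl
      rw [mul_one]
  simp only [this]
  push_cast
  rfl

theorem exists_comp_castHom_of_isPeriodicPt [NeZero n] {m : ℕ} (hm : m ∣ n)
    {w : ZMod n → Fin a} (hw : Function.IsPeriodicPt (cyclicShift n a) m w) :
    ∃ v : ZMod m → Fin a, v ∘ ZMod.castHom hm (ZMod m) = w := by
  have hm0 : NeZero m := ⟨fun h => NeZero.ne n (Nat.eq_zero_of_zero_dvd (h ▸ hm))⟩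
  refine ⟨fun y => w (y.val : ZMod n), funext fun x => ?_⟩
  have h1 : ((ZMod.castHom hm (ZMod m) x).val : ℕ) = x.val % m := by
    conv_lhs => rw [← ZMod.natCast_zmod_val x]
    rw [map_natCast, ZMod.val_natCast]
  simp only [Function.comp_apply, h1]
  have h2 := isPeriodicPt_cyclicShift_iff.1 (hw.mul_const (x.val / m)) ((x.val % m : ℕ) : ZMod n)
  rw [← h2, ← Nat.cast_add, Nat.mod_add_div, ZMod.natCast_zmod_val]

theorem card_fiber_castHom [NeZero n] {m : ℕ} [NeZero m] (hm : m ∣ n) (y : ZMod m) :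
    #{x : ZMod n | ZMod.castHom hm (ZMod m) x = y} = n / m := by
  have hsurj : Function.Surjective (ZMod.castHom hm (ZMod m)) := ZMod.castHom_surjective hm
  have hconst (z : ZMod m) : #{x : ZMod n | ZMod.castHom hm (ZMod m) x = z} =
      #{x : ZMod n | ZMod.castHom hm (ZMod m) x = y} := by
    obtain ⟨x₀, hx₀⟩ := hsurj (y - z)
    exact Finset.card_equiv (Equiv.addRight x₀) fun x => by
      simp only [mem_filter, mem_univ, true_and, Equiv.coe_addRight, map_add, hx₀]
      constructor
      · rintro h; rw [h]; ring
      · intro h; linear_combination h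
  have hsum := card_eq_sum_card_fiberwise (f := ZMod.castHom hm (ZMod m)) (s := univ)
    (t := univ) fun _ _ => by simp
  simp only [hconst, sum_const, card_univ, ZMod.card, smul_eq_mul] at hsum
  exact (Nat.div_eq_of_eq_mul_right (Nat.pos_of_ne_zero (NeZero.ne m)) hsum).symm

theorem card_fiber_comp_castHom [NeZero n] {m : ℕ} [NeZero m] (hm : m ∣ n)
    (v : ZMod m → Fin a) (i : Fin a) :
    #{x : ZMod n | (v ∘ ZMod.castHom hm (ZMod m)) x = i} = n / m * #{y | v y = i} := by
  simp only [Function.comp_apply]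
  rw [card_eq_sum_card_fiberwise (f := ZMod.castHom hm (ZMod m)) (t := univ.filter fun y => v y = i)
    fun x hx => mem_coe.2 (mem_filter.2 ⟨mem_univ _, (mem_filter.1 hx).2⟩), sum_congr rfl fun y hy => ?_, sum_const, smul_eq_mul, mul_comm]
  rw [← card_fiber_castHom hm y]
  congr 1
  ext x
  simp only [mem_filter, mem_univ, true_and] at hy ⊢
  exact ⟨fun h => h.2, fun h => ⟨h ▸ hy, h⟩⟩

open Classical in
theorem card_filter_isPeriodicPt_div [NeZero n] {d : ℕ} [NeZero (n / d)] (hd : d ∣ n) (hdr : ∀ i, d ∣ r i) :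
    #((wordsOfContent (ZMod n) r).filter
      fun w => Function.IsPeriodicPt (cyclicShift n a) (n / d) w) =
    #(wordsOfContent (ZMod (n / d)) fun i => r i / d) := by
  have hm : n / d ∣ n := Nat.div_dvd_of_dvd hd
  have hd0 : 0 < d := Nat.pos_of_dvd_of_pos hd (NeZero.pos n)
  have hq : n / (n / d) = d := Nat.div_div_self hd (NeZero.ne n)
  have hmem (v : ZMod (n / d) → Fin a) :
      v ∘ ZMod.castHom hm (ZMod (n / d)) ∈ wordsOfContent (ZMod n) r ↔
        v ∈ wordsOfContent (ZMod (n / d)) fun i => r i / d := by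
    simp only [mem_wordsOfContent, card_fiber_comp_castHom, hq]
    refine forall_congr' fun i => ?_
    rw [eq_comm, ← Nat.div_eq_iff_eq_mul_right hd0 (hdr i), eq_comm]
  symm
  refine card_bij (fun v _ => v ∘ ZMod.castHom hm (ZMod (n / d))) ?_ ?_ ?_
  · intro v hv
    refine mem_filter.2 ⟨(hmem v).2 hv, isPeriodicPt_cyclicShift_iff.2 fun j => ?_⟩
    simp only [Function.comp_apply, map_add, map_natCast, ZMod.natCast_self, add_zero]
  · intro v _ v' _ h
    exact (ZMod.castHom_surjective hm).injective_comp_right h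
  · intro w hw
    obtain ⟨hwr, hwp⟩ := mem_filter.1 hw
    obtain ⟨v, rfl⟩ := exists_comp_castHom_of_isPeriodicPt hm hwp
    exact ⟨v, (hmem v).1 hwr, rfl⟩

theorem dvd_content_of_isPeriodicPt [NeZero n] {d : ℕ} (hd : d ∣ n) {w : ZMod n → Fin a}
    (hw : w ∈ wordsOfContent (ZMod n) r)
    (hwp : Function.IsPeriodicPt (cyclicShift n a) (n / d) w) (i : Fin a) : d ∣ r i := by
  have hm : n / d ∣ n := Nat.div_dvd_of_dvd hd
  have : NeZero (n / d) := ⟨(Nat.div_pos (Nat.le_of_dvd (NeZero.pos n) hd)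
    (Nat.pos_of_dvd_of_pos hd (NeZero.pos n))).ne'⟩
  obtain ⟨v, rfl⟩ := exists_comp_castHom_of_isPeriodicPt hm hwp
  rw [← mem_wordsOfContent.1 hw i, card_fiber_comp_castHom,
    Nat.div_div_self hd (NeZero.ne n)]
  exact dvd_mul_right _ _

theorem card_primitiveWords [NeZero n] (hr : ∑ i, r i = n) :
    (#(primitiveWords n r) : ℚ) = ∑ d ∈ (Nat.gcd n (Finset.univ.gcd r)).divisors,
        (ArithmeticFunction.moebius d : ℚ) * (Nat.factorial (n / d) : ℚ) /
          ∏ i, (Nat.factorial (r i / d) : ℚ) := by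
  classical
  have h1 : (#(primitiveWords n r) : ℚ) = ∑ d ∈ n.divisors,
      (ArithmeticFunction.moebius d : ℚ) * #((wordsOfContent (ZMod n) r).filter
        fun w => Function.IsPeriodicPt (cyclicShift n a) (n / d) w) := by
    rw [primitiveWords, card_filter]
    push_cast
    rw [sum_congr rfl fun w _ => (sum_moebius_isPeriodicPt w).symm, sum_comm]
    refine sum_congr rfl fun d _ => ?_
    rw [← sum_filter, sum_const, nsmul_eq_mul, mul_comm]
  rw [h1]
  have hsub : (Nat.gcd n (Finset.univ.gcd r)).divisors ⊆ n.divisors :=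
    Nat.divisors_subset_of_dvd (NeZero.ne n) (Nat.gcd_dvd_left _ _)
  have hgcd (d : ℕ) : d ∈ (Nat.gcd n (Finset.univ.gcd r)).divisors ↔ d ∣ n ∧ ∀ i, d ∣ r i := by
    rw [Nat.mem_divisors, Nat.dvd_gcd_iff, Finset.dvd_gcd_iff]
    simp [NeZero.ne n]
  rw [← sum_subset hsub]
  · refine sum_congr rfl fun d hd => ?_
    obtain ⟨hdn, hdr⟩ := (hgcd d).1 hd
    have hd0 : 0 < d := Nat.pos_of_dvd_of_pos hdn (NeZero.pos n)
    have : NeZero (n / d) := ⟨(Nat.div_pos (Nat.le_of_dvd (NeZero.pos n) hdn) hd0).ne'⟩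
    have hsum : ∑ i, r i / d = Fintype.card (ZMod (n / d)) := by
      rw [ZMod.card, ← hr, Nat.sum_div fun i _ => hdr i]
    have hcount := card_wordsOfContent_mul hsum
    rw [ZMod.card] at hcount
    rw [card_filter_isPeriodicPt_div hdn hdr, mul_div_assoc, ← hcount]
    push_cast
    have hprod : ∏ i, ((r i / d).factorial : ℚ) ≠ 0 :=
      prod_ne_zero_iff.2 fun i _ => Nat.cast_ne_zero.2 (Nat.factorial_ne_zero _)
    rw [mul_div_cancel_right₀ _ hprod]
  · intro d hd hnd
    rw [card_eq_zero.2, Nat.cast_zero, mul_zero]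
    refine filter_eq_empty_iff.2 fun w hw hwp => hnd ((hgcd d).2 ?_)
    have hdn := Nat.dvd_of_mem_divisors hd
    exact ⟨hdn, dvd_content_of_isPeriodicPt hdn hw hwp⟩

end Primitive

section Labelings

variable {n a : ℕ} {r : Fin a → ℕ}

/-- The labelings `e` of the `n`-cycle by `Fin n` for which the cyclic successor map
`e i ↦ e (i + 1)` is increasing on every fiber of `f`. -/
def cycleLabelings (n : ℕ) [NeZero n] {a : ℕ} (f : Fin n → Fin a) : Finset (ZMod n ≃ Fin n) :=
  univ.filter fun e => ∀ i j, f (e i) = f (e j) → e i < e j → e (i + 1) < e (j + 1)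

theorem mem_cycleLabelings [NeZero n] {f : Fin n → Fin a} {e : ZMod n ≃ Fin n} :
    e ∈ cycleLabelings n f ↔
      ∀ i j, f (e i) = f (e j) → e i < e j → e (i + 1) < e (j + 1) := by
  simp [cycleLabelings]

/-- The infinite word read cyclically from `w` starting at `j`, ordered lexicographically. -/
def cyclicSuffix (w : ZMod n → Fin a) (j : ZMod n) : Lex (ℕ → Fin a) :=
  toLex fun k => w (j + k)

theorem cyclicSuffix_injective [NeZero n] {w : ZMod n → Fin a}
    (hw : Function.minimalPeriod (cyclicShift n a) w = n) :
    Function.Injective (cyclicSuffix w) := by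
  intro i j hij
  have h : Function.IsPeriodicPt (cyclicShift n a) (j - i).val w := by
    refine isPeriodicPt_cyclicShift_iff.2 fun x => ?_
    have := congrFun (congrArg ofLex hij) (x - i).val
    simp only [cyclicSuffix, ofLex_toLex, ZMod.natCast_zmod_val] at this ⊢
    rw [add_sub_cancel] at this
    rw [this]
    congr 1
    ring
  have hdvd := h.minimalPeriod_dvd
  rw [hw] at hdvd
  have h0 := Nat.eq_zero_of_dvd_of_lt hdvd (ZMod.val_lt _)
  exact (sub_eq_zero.1 ((ZMod.val_eq_zero _).1 h0)).symm

theorem cyclicSuffix_lt_cyclicSuffix_iff {w : ZMod n → Fin a} {i j : ZMod n} :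
    cyclicSuffix w i < cyclicSuffix w j ↔
      ∃ k : ℕ, (∀ l < k, w (i + l) = w (j + l)) ∧ w (i + k) < w (j + k) :=
  Iff.rfl

theorem cyclicSuffix_add_one_lt {w : ZMod n → Fin a} {i j : ZMod n} (hw : w i = w j)
    (h : cyclicSuffix w i < cyclicSuffix w j) :
    cyclicSuffix w (i + 1) < cyclicSuffix w (j + 1) := by
  obtain ⟨k, hk, hlt⟩ := cyclicSuffix_lt_cyclicSuffix_iff.1 h
  obtain _ | k := k
  · simp [hw] at hlt
  · refine cyclicSuffix_lt_cyclicSuffix_iff.2 ⟨k, fun l hl => ?_, ?_⟩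
    · have := hk (l + 1) (by omega)
      push_cast at this
      rwa [add_comm (l : ZMod n), ← add_assoc, ← add_assoc] at this
    · push_cast at hlt
      rwa [add_comm (k : ZMod n), ← add_assoc, ← add_assoc] at hlt

theorem apply_le_of_cyclicSuffix_le {w : ZMod n → Fin a} {i j : ZMod n}
    (h : cyclicSuffix w i ≤ cyclicSuffix w j) : w i ≤ w j := by
  rcases h.eq_or_lt with h | h
  · have := congrFun (congrArg ofLex h) 0
    simp only [cyclicSuffix, ofLex_toLex, Nat.cast_zero, add_zero] at this
    exact this.le
  · obtain ⟨k, hk, hlt⟩ := cyclicSuffix_lt_cyclicSuffix_iff.1 h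
    obtain _ | k := k
    · simpa using hlt.le
    · simpa using (hk 0 (by omega)).le

theorem lt_add_of_mem_cycleLabelings [NeZero n] {f : Fin n → Fin a} {e : ZMod n ≃ Fin n}
    (he : e ∈ cycleLabelings n f) {i j : ZMod n} {k : ℕ}
    (hk : ∀ l < k, f (e (i + l)) = f (e (j + l))) (h : e i < e j) : e (i + k) < e (j + k) := by
  induction k with
  | zero => simpa using h
  | succ k ih =>
    push_cast
    rw [← add_assoc, ← add_assoc]
    exact mem_cycleLabelings.1 he _ _ (hk k (by omega)) (ih fun l hl => hk l (by omega))

theorem minimalPeriod_comp_of_mem_cycleLabelings [NeZero n] {f : Fin n → Fin a}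
    {e : ZMod n ≃ Fin n} (he : e ∈ cycleLabelings n f) :
    Function.minimalPeriod (cyclicShift n a) (f ∘ e) = n := by
  have hp := isPeriodicPt_cyclicShift_iff.1
    (Function.isPeriodicPt_minimalPeriod (cyclicShift n a) (f ∘ e))
  refine Nat.dvd_antisymm (isPeriodicPt_cyclicShift_self _).minimalPeriod_dvd ?_
  set p := Function.minimalPeriod (cyclicShift n a) (f ∘ e)
  simp only [Function.comp_apply] at hp
  have hfe (l : ℕ) : f (e (0 + l)) = f (e ((p : ZMod n) + l)) := by
    rw [zero_add, add_comm, hp]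
  have hsucc (m : ℕ) : (((m + 1) * p : ℕ) : ZMod n) = p + (m * p : ℕ) := by
    push_cast
    ring
  -- A strict inequality between `e 0` and `e p` would propagate around the cycle.
  have key : e 0 = e (p : ZMod n) := by
    rcases lt_trichotomy (e 0) (e p) with h | h | h
    · have hmono : StrictMono fun m : ℕ => e ((m * p : ℕ) : ZMod n) := by
        refine strictMono_nat_of_lt_succ fun m => ?_
        have := lt_add_of_mem_cycleLabelings he (k := m * p) (fun l _ => hfe l) h
        rw [zero_add] at this
        rwa [hsucc]
      exact absurd (hmono (NeZero.pos n)) (by simp)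
    · exact h
    · have hanti : StrictAnti fun m : ℕ => e ((m * p : ℕ) : ZMod n) := by
        refine strictAnti_nat_of_succ_lt fun m => ?_
        have := lt_add_of_mem_cycleLabelings he (k := m * p) (fun l _ => (hfe l).symm) h
        rw [zero_add] at this
        rwa [hsucc]
      exact absurd (hanti (NeZero.pos n)) (by simp)
  exact (ZMod.natCast_eq_zero_iff _ _).1 (e.injective key).symm

theorem lt_iff_cyclicSuffix_lt [NeZero n] {f : Fin n → Fin a} (hf : Monotone f)
    {e : ZMod n ≃ Fin n} (he : e ∈ cycleLabelings n f) {i j : ZMod n} :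
    e i < e j ↔ cyclicSuffix (f ∘ e) i < cyclicSuffix (f ∘ e) j := by
  have himp (i j : ZMod n) (h : cyclicSuffix (f ∘ e) i < cyclicSuffix (f ∘ e) j) :
      e i < e j := by
    have hne : e j ≠ e i := fun hc => by
      rw [e.injective hc] at h
      exact lt_irrefl _ h
    obtain ⟨k, hk, hlt⟩ := cyclicSuffix_lt_cyclicSuffix_iff.1 h
    by_contra hij
    have := lt_add_of_mem_cycleLabelings he (fun l hl => (hk l hl).symm)
      (lt_of_le_of_ne (not_lt.1 hij) hne)
    exact absurd (hf this.le) (not_le.2 hlt)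
  refine ⟨fun h => ?_, himp i j⟩
  rcases lt_trichotomy (cyclicSuffix (f ∘ e) i) (cyclicSuffix (f ∘ e) j) with h' | h' | h'
  · exact h'
  · rw [cyclicSuffix_injective (minimalPeriod_comp_of_mem_cycleLabelings he) h'] at h
    exact absurd h (lt_irrefl _)
  · exact absurd h (himp j i h').asymm

theorem exists_equiv_fin_lt_iff {α β : Type*} [Fintype α] [LinearOrder β] {s : α → β}
    (hs : Function.Injective s) (hcard : Fintype.card α = n) :
    ∃ e : α ≃ Fin n, ∀ i j, e i < e j ↔ s i < s j := by
  let _ : LinearOrder α := LinearOrder.lift' s hs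
  let e : Fin n ≃o α := Fintype.orderIsoFinOfCardEq α hcard
  exact ⟨e.symm.toEquiv, fun i j => e.symm.lt_iff_lt⟩

theorem card_cycleLabelings [NeZero n] {f : Fin n → Fin a} (hf : Monotone f)
    (hfr : f ∈ wordsOfContent (Fin n) r) : #(cycleLabelings n f) = #(primitiveWords n r) := by
  refine card_bij (fun e _ => f ∘ e) ?_ ?_ ?_
  · intro e he
    exact mem_filter.2 ⟨comp_perm_mem_wordsOfContent hfr e,
      minimalPeriod_comp_of_mem_cycleLabelings he⟩
  · intro e he e' he' h
    have hlt {i j : ZMod n} : e i < e j ↔ e' i < e' j := by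
      rw [lt_iff_cyclicSuffix_lt hf he, lt_iff_cyclicSuffix_lt hf he', h]
    let φ : Fin n ≃o Fin n :=
      { toEquiv := e.symm.trans e'
        map_rel_iff' := fun {x y} => by
          rw [← not_lt, ← not_lt]
          simp [← hlt] }
    ext j : 1
    have := DFunLike.congr_fun (Subsingleton.elim φ (OrderIso.refl _)) (e j)
    simpa [φ] using this.symm
  · intro w hw
    obtain ⟨hwr, hwp⟩ := mem_filter.1 hw
    obtain ⟨e, he⟩ := exists_equiv_fin_lt_iff (cyclicSuffix_injective hwp) (ZMod.card n)
    have hwf : w ∘ e.symm = f := by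
      refine Monotone.eq_of_mem_wordsOfContent (fun x y hxy => ?_) hf
        (comp_perm_mem_wordsOfContent hwr e.symm) hfr
      refine apply_le_of_cyclicSuffix_le (not_lt.1 fun h => ?_)
      rw [← he] at h
      simp only [Equiv.apply_symm_apply] at h
      exact absurd hxy (not_le.2 h)
    refine ⟨e, mem_cycleLabelings.2 fun i j hij hlt => ?_, ?_⟩
    · simp only [← hwf, Function.comp_apply, Equiv.symm_apply_apply] at hij
      rw [he] at hlt ⊢
      exact cyclicSuffix_add_one_lt hij hlt
    · rw [← hwf, Function.comp_assoc, Equiv.symm_comp_self, Function.comp_id]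

end Labelings

section Cycles

variable {n a : ℕ} {r : Fin a → ℕ}

theorem fullCycleType_eq_singleton_iff (hn : 0 < n) (π : Perm (Fin n)) :
    fullCycleType n π = {n} ↔ π.IsCycleOn (univ : Finset (Fin n)) := by
  obtain rfl | hn1 : n = 1 ∨ 1 < n := by omega
  · refine iff_of_true ?_ (Equiv.Perm.isCycleOn_of_subsingleton _ _)
    rw [Subsingleton.elim π 1]
    simp [fullCycleType]
  · have : Nontrivial (Fin n) := Fin.nontrivial_iff_two_le.2 hn1
    constructor
    · intro h
      have hrep : n - π.cycleType.sum = 0 := by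
        by_contra h0
        have h1 : 1 ∈ fullCycleType n π :=
          Multiset.mem_add.2 (Or.inr (Multiset.mem_replicate.2 ⟨h0, rfl⟩))
        rw [h, Multiset.mem_singleton] at h1
        omega
      rw [fullCycleType, hrep, Multiset.replicate_zero, add_zero] at h
      have hcyc : π.IsCycle := Equiv.Perm.card_cycleType_eq_one.1 (by rw [h]; simp)
      have hsupp : π.support = univ := by
        rw [← card_eq_iff_eq_univ, ← Equiv.Perm.sum_cycleType, h]
        simp
      have := hcyc.isCycleOn
      convert this using 1
      ext x
      simpa using (Finset.ext_iff.1 hsupp x)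
    · intro h
      have hne (x : Fin n) : π x ≠ x :=
        h.apply_ne (by simpa using Set.nontrivial_univ) (by simp)
      have hcyc : π.IsCycle :=
        ⟨⟨0, hn⟩, hne _, fun y _ => h.2 (by simp) (by simp)⟩
      have hsupp : π.support = univ := by
        ext x
        simp [hne]
      simp [fullCycleType, hcyc.cycleType, hsupp]

/-- The permutation sending the label of each point of the `n`-cycle to the next label. -/
def cyclePerm (e : ZMod n ≃ Fin n) : Perm (Fin n) :=
  (e.symm.trans (Equiv.addRight 1)).trans e

@[simp]
theorem cyclePerm_apply (e : ZMod n ≃ Fin n) (j : ZMod n) : cyclePerm e (e j) = e (j + 1) := by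
  simp [cyclePerm]

theorem cyclePerm_pow_apply (e : ZMod n ≃ Fin n) (k : ℕ) (j : ZMod n) :
    (cyclePerm e ^ k) (e j) = e (j + k) := by
  induction k with
  | zero => simp
  | succ k ih =>
    rw [pow_succ', Perm.mul_apply, ih, cyclePerm_apply]
    push_cast
    rw [add_assoc]

theorem isCycleOn_cyclePerm [NeZero n] (e : ZMod n ≃ Fin n) :
    (cyclePerm e).IsCycleOn (univ : Finset (Fin n)) := by
  refine ⟨by simp, fun x _ y _ => ?_⟩
  obtain ⟨i, rfl⟩ := e.surjective x
  obtain ⟨j, rfl⟩ := e.surjective y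
  refine ⟨((j - i).val : ℕ), ?_⟩
  rw [zpow_natCast, cyclePerm_pow_apply, ZMod.natCast_zmod_val, add_sub_cancel]

theorem exists_cyclePerm_eq [NeZero n] {π : Perm (Fin n)}
    (hπ : π.IsCycleOn (univ : Finset (Fin n))) (x : Fin n) :
    ∃ e : ZMod n ≃ Fin n, cyclePerm e = π ∧ e 0 = x := by
  have hpow {k l : ℕ} : (π ^ k) x = (π ^ l) x ↔ k ≡ l [MOD n] := by
    simpa using hπ.pow_apply_eq_pow_apply (mem_univ x) (m := k) (n := l)
  have hinj : Function.Injective fun j : ZMod n => (π ^ j.val) x := fun i j hij => by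
    have := (ZMod.natCast_eq_natCast_iff _ _ _).2 (hpow.1 hij)
    simpa using this
  let e : ZMod n ≃ Fin n :=
    Equiv.ofBijective _ ((Fintype.bijective_iff_injective_and_card _).2 ⟨hinj, by simp⟩)
  have he (j : ZMod n) : e j = (π ^ j.val) x := rfl
  refine ⟨e, Equiv.ext fun y => ?_, by simp [he]⟩
  obtain ⟨j, rfl⟩ := e.surjective y
  rw [cyclePerm_apply, he, he, ← Perm.mul_apply, ← pow_succ', hpow,
    ← ZMod.natCast_eq_natCast_iff]
  simp

theorem mem_cycleLabelings_iff_cyclePerm [NeZero n] {f : Fin n → Fin a} {e : ZMod n ≃ Fin n} :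
    e ∈ cycleLabelings n f ↔
      ∀ x y, f x = f y → x < y → cyclePerm e x < cyclePerm e y := by
  simp only [mem_cycleLabelings, e.symm.forall_congr_left, ← cyclePerm_apply, Equiv.symm_symm]

open Classical in
theorem card_mul_eq_card_cycleLabelings [NeZero n] (f : Fin n → Fin a) :
    #{π : Perm (Fin n) | π.IsCycleOn (univ : Finset (Fin n)) ∧
      ∀ x y, f x = f y → x < y → π x < π y} * n = #(cycleLabelings n f) := by
  have hn : n = #(univ : Finset (Fin n)) := by simp
  refine ((congrArg (_ * ·) hn).trans (card_product _ _).symm).trans (Eq.symm ?_)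
  refine card_bij (fun e _ => (cyclePerm e, e 0)) ?_ ?_ ?_
  · intro e he
    exact mem_product.2 ⟨mem_filter.2 ⟨mem_univ _, isCycleOn_cyclePerm e,
      mem_cycleLabelings_iff_cyclePerm.1 he⟩, mem_univ _⟩
  · intro e _ e' _ h
    obtain ⟨hπ, h0⟩ := Prod.mk.inj h
    ext j : 1
    have h1 := cyclePerm_pow_apply e j.val 0
    have h2 := cyclePerm_pow_apply e' j.val 0
    rw [hπ, h0, h2] at h1
    simpa using h1.symm
  · rintro ⟨π, x⟩ h
    obtain ⟨-, hπ, hf⟩ := mem_filter.1 (mem_product.1 h).1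
    obtain ⟨e, rfl, rfl⟩ := exists_cyclePerm_eq hπ x
    exact ⟨e, mem_cycleLabelings_iff_cyclePerm.2 hf, rfl⟩

end Cycles

/-- The number of `n`-cycles in `S_n` with descent set contained in
`{r₁, r₁+r₂, …, r₁+⋯+r_a = n}` equals
`M(r₁,…,r_a) = (1/n) ∑_{d | gcd(n,r₁,…,r_a)} μ(d) (n/d)! / ((r₁/d)! ⋯ (r_a/d)!)`. -/
theorem stmt5 (n a : ℕ) (hn : 0 < n) (r : Fin a → ℕ) (hr : ∑ i, r i = n) :
    (Nat.card {π : Equiv.Perm (Fin n) //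
        fullCycleType n π = {n} ∧ descentSet n π ⊆ partialSumsF a r} : ℚ) =
      (1 / n) * ∑ d ∈ (Nat.gcd n (Finset.univ.gcd r)).divisors,
        (ArithmeticFunction.moebius d : ℚ) * (Nat.factorial (n / d) : ℚ) /
          ∏ i, (Nat.factorial (r i / d) : ℚ) := by
  classical
  have : NeZero n := ⟨hn.ne'⟩
  obtain ⟨f, hfr, hf⟩ := exists_monotone_mem_wordsOfContent hr
  have hcount := card_mul_eq_card_cycleLabelings f
  rw [card_cycleLabelings hf hfr] at hcount
  have hn0 : (n : ℚ) ≠ 0 := Nat.cast_ne_zero.2 hn.ne'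
  rw [← card_primitiveWords hr, ← hcount, Nat.card_eq_fintype_card, Fintype.card_subtype]
  simp only [fullCycleType_eq_singleton_iff hn,
    descentSet_subset_partialSumsF_iff hn hr hf hfr]
  push_cast
  field_simp
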